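/- Let g : ℤ → ℤ be a grouping function, let S be a finite nonempty multiset of integers, let k ∈ {1,…,|S|}, set r = rank_{rank_{g⟦S⟧}(ℤ)}(k − 1) and q = select_{g(S)}(r). Then rank_{g(S)}(q − 1) + 1 = r and rank_{g(S)}(q) = r; consequently select_S(k) = select_{S ∩ g⁻¹(q)}(k − select_{rank_{g⟦S⟧}(ℤ)}(r)). -/

import Mathlib

/-- `mrank S j` is the rank of `j` in the multiset `S` of integers:
the number of elements of `S` (counted with multiplicity) that are at most `j`. -/
def mrank (S : Multiset ℤ) (j : ℤ) : ℕ := (S.filter (· ≤ j)).card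

/-- `mselect S k` is the select operation: the least `j : ℤ` with `k ≤ mrank S j`. -/
noncomputable def mselect (S : Multiset ℤ) (k : ℤ) : ℤ := sInf {j : ℤ | k ≤ (mrank S j : ℤ)}

/-- `srank A j` is the rank of `j` in the (simple) set `A` of integers. -/
noncomputable def srank (A : Set ℤ) (j : ℤ) : ℕ := {i ∈ A | i ≤ j}.ncard

/-- `sselect A k` is the select operation for a set of integers. -/
noncomputable def sselect (A : Set ℤ) (k : ℤ) : ℤ := sInf {j : ℤ | k ≤ (srank A j : ℤ)}

/-- The support `⟨S⟩` of a multiset of integers, as a set. -/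
def msupp (S : Multiset ℤ) : Set ℤ := {x | x ∈ S}

/-- `rank_S(ℤ)`: the image of the function `mrank S`, as a set of integers. -/
def rankImage (S : Multiset ℤ) : Set ℤ := Set.range fun j : ℤ => (mrank S j : ℤ)

/-- A grouping function: a nondecreasing `g : ℤ → ℤ` all of whose fibers are finite. -/
def GroupingFunction (g : ℤ → ℤ) : Prop := Monotone g ∧ ∀ q : ℤ, (g ⁻¹' {q}).Finite


theorem Int.csInf_setOf_eq_of_not_pred {P : ℤ → Prop} (hP : ∀ a b, a ≤ b → P a → P b) {j : ℤ}
    (hj : P j) (hj' : ¬ P (j - 1)) : sInf {i : ℤ | P i} = j := by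
  have hleast : IsLeast {i : ℤ | P i} j := by
    refine ⟨hj, fun i hi => ?_⟩
    by_contra! hlt
    exact hj' (hP i (j - 1) (by omega) hi)
  exact hleast.csInf_eq

theorem mrank_mono (S : Multiset ℤ) : Monotone (mrank S) := fun _ _ hab =>
  Multiset.card_le_card (Multiset.monotone_filter_right S fun _ h => le_trans h hab)

theorem mrank_le_card (S : Multiset ℤ) (j : ℤ) : mrank S j ≤ Multiset.card S :=
  Multiset.card_le_card (Multiset.filter_le _ _)

theorem mselect_eq {S : Multiset ℤ} {k j : ℤ} (h : k ≤ mrank S j) (h' : (mrank S (j - 1) : ℤ) < k) :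
    mselect S k = j :=
  Int.csInf_setOf_eq_of_not_pred (P := fun i => k ≤ (mrank S i : ℤ))
    (fun _ _ hab ha => ha.trans (by exact_mod_cast mrank_mono S hab)) h (by simpa using h')

theorem exists_mrank_eq_zero (S : Multiset ℤ) : ∃ a, ∀ j ≤ a, mrank S j = 0 := by
  obtain ⟨a, ha⟩ := S.toFinset.bddBelow
  refine ⟨a - 1, fun j hj => ?_⟩
  rw [mrank, Multiset.card_eq_zero, Multiset.filter_eq_nil]
  intro i hi hij
  have := ha (show i ∈ (S.toFinset : Set ℤ) by simpa using hi)
  omega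

theorem exists_mrank_eq_card (S : Multiset ℤ) : ∃ b, mrank S b = Multiset.card S := by
  obtain ⟨b, hb⟩ := S.toFinset.bddAbove
  refine ⟨b, ?_⟩
  rw [mrank, Multiset.filter_eq_self.2]
  intro i hi
  exact hb (show i ∈ (S.toFinset : Set ℤ) by simpa using hi)

/-- The index at which the rank function of `S` reaches `k`. -/
theorem exists_mrank_jump {S : Multiset ℤ} {k : ℤ} (hk1 : 1 ≤ k) (hk2 : k ≤ Multiset.card S) :
    ∃ j, k ≤ mrank S j ∧ (mrank S (j - 1) : ℤ) < k := by
  obtain ⟨a, ha⟩ := exists_mrank_eq_zero S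
  obtain ⟨b, hb⟩ := exists_mrank_eq_card S
  obtain ⟨j, hj, hmin⟩ := Int.exists_least_of_bdd (P := fun j => k ≤ (mrank S j : ℤ))
    ⟨a, fun z hz => by
      by_contra! hlt
      have := ha z hlt.le
      omega⟩ ⟨b, by omega⟩
  refine ⟨j, hj, ?_⟩
  by_contra! h
  have := hmin _ h
  omega

theorem mem_of_mrank_lt {S : Multiset ℤ} {j : ℤ} (h : mrank S (j - 1) < mrank S j) : j ∈ S := by
  by_contra hj
  refine h.ne ?_
  rw [mrank, mrank]
  congr 1
  refine Multiset.filter_congr fun i hi => ?_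
  have : i ≠ j := fun e => hj (e ▸ hi)
  omega

theorem mrank_lt_of_mem {S : Multiset ℤ} {i j : ℤ} (hj : j ∈ S) (hij : i < j) :
    mrank S i < mrank S j := by
  refine Multiset.card_lt_card (lt_of_le_of_ne
    (Multiset.monotone_filter_right S fun _ h => le_trans h hij.le) fun e => ?_)
  have : j ∈ S.filter (· ≤ i) := e ▸ Multiset.mem_filter.2 ⟨hj, le_rfl⟩
  have := (Multiset.mem_filter.1 this).2
  omega

theorem mrank_pos_of_mem {S : Multiset ℤ} {j : ℤ} (hj : j ∈ S) : 0 < mrank S j :=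
  (Nat.zero_le _).trans_lt (mrank_lt_of_mem hj (sub_one_lt j))

theorem msupp_finite (S : Multiset ℤ) : (msupp S).Finite := by
  convert S.toFinset.finite_toSet
  ext x
  simp [msupp]

theorem msupp_map (g : ℤ → ℤ) (S : Multiset ℤ) : msupp (S.map g) = g '' msupp S := by
  ext x
  simp [msupp]

theorem rankImage_finite (S : Multiset ℤ) : (rankImage S).Finite := by
  refine (Set.finite_Icc (0 : ℤ) (Multiset.card S)).subset ?_
  rintro _ ⟨j, rfl⟩
  exact ⟨Int.natCast_nonneg _, Int.ofNat_le.2 (mrank_le_card S j)⟩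

theorem srank_mono {A : Set ℤ} (hA : A.Finite) : Monotone (srank A) := fun _ _ hab =>
  Set.ncard_le_ncard (fun _ hx => ⟨hx.1, hx.2.trans hab⟩) (hA.subset fun _ hx => hx.1)

theorem srank_eq_srank_pred_add_one {A : Set ℤ} (hA : A.Finite) {j : ℤ} (hj : j ∈ A) :
    srank A j = srank A (j - 1) + 1 := by
  have : {i ∈ A | i ≤ j} = insert j {i ∈ A | i ≤ j - 1} := by
    ext x
    simp only [Set.mem_ofPred_eq, Set.mem_insert_iff]
    constructor
    · rintro ⟨h, h'⟩
      by_cases hx : x = j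
      · exact Or.inl hx
      · exact Or.inr ⟨h, by omega⟩
    · rintro (rfl | ⟨h, h'⟩)
      · exact ⟨hj, le_rfl⟩
      · exact ⟨h, by omega⟩
  rw [srank, srank, this, Set.ncard_insert_of_notMem _ (hA.subset fun _ hx => hx.1)]
  rintro ⟨-, h⟩
  omega

theorem sselect_srank {A : Set ℤ} (hA : A.Finite) {j : ℤ} (hj : j ∈ A) :
    sselect A (srank A j) = j := by
  refine Int.csInf_setOf_eq_of_not_pred (P := fun i => (srank A j : ℤ) ≤ (srank A i : ℤ))
    (fun _ _ hab ha => ha.trans (by exact_mod_cast srank_mono hA hab)) le_rfl ?_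
  have := srank_eq_srank_pred_add_one hA hj
  omega

theorem exists_mem_mrank_eq {S : Multiset ℤ} {j : ℤ} (h : 0 < mrank S j) :
    ∃ i ∈ S, i ≤ j ∧ mrank S i = mrank S j := by
  have hcard := mrank_le_card S j
  obtain ⟨i, hi, hi'⟩ := exists_mrank_jump (S := S) (k := mrank S j) (by omega)
    (by omega)
  have hij : i ≤ j := by
    by_contra! hlt
    have := mrank_mono S (show j ≤ i - 1 by omega)
    omega
  have := mrank_mono S hij
  exact ⟨i, mem_of_mrank_lt (by omega), hij, by omega⟩

/-- The values of the rank function up to `mrank S j` are `0` and one value for each element of the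
support up to `j`. -/
theorem srank_rankImage (S : Multiset ℤ) (j : ℤ) :
    srank (rankImage S) (mrank S j) = srank (msupp S) j + 1 := by
  have hset : {c ∈ rankImage S | c ≤ mrank S j} =
      insert 0 ((fun i => (mrank S i : ℤ)) '' {i ∈ msupp S | i ≤ j}) := by
    ext c
    simp only [Set.mem_ofPred_eq, Set.mem_insert_iff, Set.mem_image]
    constructor
    · rintro ⟨⟨t, rfl⟩, hc⟩
      rcases Nat.eq_zero_or_pos (mrank S t) with h0 | hpos
      · left
        simpa using h0
      · right
        obtain ⟨i, hiS, hit, hi⟩ := exists_mem_mrank_eq hpos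
        refine ⟨i, ⟨hiS, ?_⟩, by simp [hi]⟩
        by_contra! hlt
        have := mrank_lt_of_mem hiS hlt
        simp only [Nat.cast_le] at hc
        omega
    · rintro (rfl | ⟨i, ⟨-, hij⟩, rfl⟩)
      · obtain ⟨a, ha⟩ := exists_mrank_eq_zero S
        exact ⟨⟨a, by simp [ha a le_rfl]⟩, by positivity⟩
      · exact ⟨⟨i, rfl⟩, by exact_mod_cast mrank_mono S hij⟩
  have hfin : {i ∈ msupp S | i ≤ j}.Finite := (msupp_finite S).subset fun _ hx => hx.1
  rw [srank, srank, hset, Set.ncard_insert_of_notMem _ (hfin.image _), Set.InjOn.ncard_image]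
  · rintro a ⟨ha, -⟩ b ⟨hb, -⟩ hab
    simp only [Nat.cast_inj] at hab
    rcases lt_trichotomy a b with h | h | h
    · exact absurd hab (mrank_lt_of_mem hb h).ne
    · exact h
    · exact absurd hab (mrank_lt_of_mem ha h).ne'
  · rintro ⟨i, ⟨hi, -⟩, h0⟩
    have := mrank_pos_of_mem hi
    simp only [Nat.cast_eq_zero] at h0
    omega

theorem srank_rankImage_of_jump {S : Multiset ℤ} {k j : ℤ} (h : k ≤ mrank S j)
    (h' : (mrank S (j - 1) : ℤ) < k) :
    srank (rankImage S) (k - 1) = srank (rankImage S) (mrank S (j - 1)) := by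
  rw [srank, srank]
  congr 1
  ext c
  simp only [Set.mem_ofPred_eq]
  constructor
  · rintro ⟨⟨t, rfl⟩, hc⟩
    refine ⟨⟨t, rfl⟩, ?_⟩
    have : t ≤ j - 1 := by
      by_contra! hlt
      have := mrank_mono S (show j ≤ t by omega)
      simp only at hc
      omega
    exact Int.ofNat_le.2 (mrank_mono S this)
  · rintro ⟨hc, hle⟩
    exact ⟨hc, by omega⟩

theorem mrank_map (g : ℤ → ℤ) (S : Multiset ℤ) (j : ℤ) :
    mrank (S.map g) j = (S.filter fun i => g i ≤ j).card := by
  simp [mrank, Multiset.filter_map]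

/-- If the elements `i ≤ j` contain all groups before `q` and no group after `q`, then the rank of
`j` splits into the sizes of the groups before `q` and the rank of `j` inside group `q`. -/
theorem mrank_eq_add_mrank_filter {g : ℤ → ℤ} (S : Multiset ℤ) {q j : ℤ}
    (h : ∀ i, g i < q → i ≤ j) (h' : ∀ i ≤ j, g i ≤ q) :
    mrank S j = mrank (S.map g) (q - 1) + mrank (S.filter fun i => g i = q) j := by
  rw [mrank_map, mrank, mrank, Multiset.filter_filter,
    ← Multiset.filter_add_not (fun i => g i ≤ q - 1) (S.filter (· ≤ j)), Multiset.card_add,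
    Multiset.filter_filter, Multiset.filter_filter]
  congr 2
  · refine Multiset.filter_congr fun i _ => ?_
    have := h i
    constructor
    · exact fun hi => hi.1
    · exact fun hi => ⟨hi, this (by omega)⟩
  · refine Multiset.filter_congr fun i _ => ?_
    have := h' i
    constructor
    · exact fun hi => ⟨hi.2, by have := this hi.2; omega⟩
    · exact fun hi => ⟨by omega, hi.1⟩

/-- Selecting in `S` amounts to selecting in the group in which the group ranks reach `k`. -/
theorem mselect_eq_mselect_filter {g : ℤ → ℤ} (hg : Monotone g) {S : Multiset ℤ} {k q : ℤ}
    (hk1 : 1 ≤ k) (hk2 : k ≤ Multiset.card S) (hq : k ≤ mrank (S.map g) q)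
    (hq' : (mrank (S.map g) (q - 1) : ℤ) < k) :
    mselect S k = mselect (S.filter fun i => g i = q) (k - mrank (S.map g) (q - 1)) := by
  obtain ⟨s, hs, hs'⟩ := exists_mrank_jump hk1 hk2
  have hgs : g s = q := by
    refine le_antisymm ?_ ?_
    · by_contra! hlt
      have hle : mrank (S.map g) q ≤ mrank S (s - 1) := by
        rw [mrank_map, mrank]
        refine Multiset.card_le_card (Multiset.monotone_filter_right S fun i hi => ?_)
        have := hg.reflect_lt (lt_of_le_of_lt hi hlt)
        show i ≤ s - 1
        omega
      omega
    · by_contra! hlt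
      have hle : mrank S s ≤ mrank (S.map g) (q - 1) := by
        rw [mrank_map, mrank]
        refine Multiset.card_le_card (Multiset.monotone_filter_right S fun i hi => ?_)
        have := hg hi
        show g i ≤ q - 1
        omega
      omega
  have hbefore : ∀ i, g i < q → i ≤ s - 1 := fun i hi => by
    have := hg.reflect_lt (hgs ▸ hi)
    omega
  have h1 := mrank_eq_add_mrank_filter S (j := s) (fun i hi => by have := hbefore i hi; omega)
    fun i hi => hgs ▸ hg hi
  have h2 := mrank_eq_add_mrank_filter S (j := s - 1) hbefore
    fun i hi => hgs ▸ hg (show i ≤ s by omega)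
  rw [mselect_eq hs hs', mselect_eq (j := s) (by omega) (by omega)]

theorem stmt18 (g : ℤ → ℤ) (hg : GroupingFunction g) (S : Multiset ℤ) (hS : S ≠ 0)
    (k : ℤ) (hk1 : 1 ≤ k) (hk2 : k ≤ (Multiset.card S : ℤ))
    (r : ℕ) (hr : r = srank (rankImage (S.map g)) (k - 1))
    (q : ℤ) (hq : q = sselect (g '' msupp S) (r : ℤ)) :
    srank (g '' msupp S) (q - 1) + 1 = r ∧
    srank (g '' msupp S) q = r ∧
    mselect S k =
      mselect (S.filter fun i => g i = q)
        (k - sselect (rankImage (S.map g)) (r : ℤ)) := by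
  obtain ⟨p, hp, hp'⟩ := exists_mrank_jump (S := S.map g) hk1 (by simpa using hk2)
  have hpmem : p ∈ msupp (S.map g) := mem_of_mrank_lt (by omega)
  rw [srank_rankImage_of_jump hp hp'] at hr
  have hrp : srank (msupp (S.map g)) p = r := by
    rw [hr, srank_rankImage, srank_eq_srank_pred_add_one (msupp_finite _) hpmem]
  rw [← msupp_map] at hq ⊢
  obtain rfl : q = p := by rw [hq, ← hrp, sselect_srank (msupp_finite _) hpmem]
  refine ⟨by rw [hr, srank_rankImage], hrp, ?_⟩
  rw [hr, sselect_srank (rankImage_finite _) ⟨q - 1, rfl⟩]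
  exact mselect_eq_mselect_filter hg.1 hk1 hk2 hp hp'
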